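/- (Theorem 2.9, (b) ⇒ (a)) Assume hypotheses (H1)–(H4). Suppose there exists a continuous V : [0,∞) × C([−r,0]; ℝⁿ) → [0,∞) such that: (i) there exist a₁, a₂ ∈ K∞ and β ∈ K⁺ with a₁(‖x‖_r) ≤ V(t,x) ≤ a₂(β(t)‖x‖_r) for all (t,x); (ii) V⁰(t, x; f(t,x,d)) ≤ −V(t,x) for all (t,x,d) ∈ [0,∞) × C([−r,0]; ℝⁿ) × D; (iii) there is a non-decreasing M : [0,∞) → [0,∞) with |V(t,y) − V(t,x)| ≤ M(R)‖y−x‖_r whenever t ∈ [0,R] and ‖x‖_r, ‖y‖_r ≤ R. Then 0 ∈ C([−r,0]; ℝⁿ) is non-uniformly in time RGAS: there exist σ ∈ KL and β̃ ∈ K⁺ such that every maximal solution with data (t₀, x₀, d) ∈ [0,∞) × C([−r,0]; ℝⁿ) × M_D is defined on [t₀,∞) and satisfies ‖T_r(t)x‖_r ≤ σ(β̃(t₀)‖x₀‖_r, t−t₀) for all t ≥ t₀. -/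

import Mathlib

open Set Filter MeasureTheory
open scoped RealInnerProductSpace

noncomputable section

/-- ℝⁿ with the Euclidean norm. -/
abbrev Euc (n : ℕ) : Type := EuclideanSpace ℝ (Fin n)

/-- The sup norm `‖y‖_q = max_{θ ∈ [-q,0]} |y θ|` of a history segment. -/
def histNorm (n : ℕ) (q : ℝ) (y : ℝ → Euc n) : ℝ :=
  sSup ((fun θ => ‖y θ‖) '' Icc (-q) 0)

/-- The class `M_D` of allowed disturbances: right-continuous maps `d : [0,∞) → D`
which are continuous outside a countable set with no finite accumulation point. -/
def MD (l : ℕ) (D : Set (Euc l)) (d : ℝ → Euc l) : Prop :=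
  (∀ t, 0 ≤ t → d t ∈ D) ∧
  (∀ t, 0 ≤ t → ∀ ε > 0, ∃ δ > 0, ∀ s, t ≤ s → s - t < δ → ‖d s - d t‖ < ε) ∧
  ∃ A : Set ℝ, (∀ C : ℝ, (A ∩ Icc 0 C).Finite) ∧
    ∀ t, 0 ≤ t → t ∉ A → ∀ ε > 0, ∃ δ > 0, ∀ s, 0 ≤ s → |s - t| < δ → ‖d s - d t‖ < ε

/-- The operator `E_h(x;v)`. -/
def Eop (n : ℕ) (x : ℝ → Euc n) (h : ℝ) (v : Euc n) : ℝ → Euc n :=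
  fun θ => if -h < θ then x 0 + (θ + h) • v else x (θ + h)

/-- The generalized (Dini-type) derivative
`V⁰(t,x;v) = limsup_{h→0⁺, y→0} (V(t+h, E_h(x;v)+h y) - V(t,x))/h` of a functional `V`
defined on `[0,∞) × C([-q,0];ℝⁿ)`, with values in the extended reals. -/
def Vdot (n : ℕ) (q : ℝ) (V : ℝ → (ℝ → Euc n) → ℝ) (t : ℝ)
    (x : ℝ → Euc n) (v : Euc n) : EReal :=
  ⨅ δ : Ioi (0:ℝ), ⨆ p : {p : ℝ × (ℝ → Euc n) //
      0 < p.1 ∧ p.1 < (δ : ℝ) ∧ ContinuousOn p.2 (Icc (-q) 0) ∧ histNorm n q p.2 < (δ : ℝ)},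
    (((V (t + p.1.1) (fun θ => Eop n x p.1.1 v θ + p.1.1 • p.1.2 θ) - V t x) / p.1.1 : ℝ) : EReal)

/-- The upper right Dini derivative `D⁺v(t) = limsup_{h→0⁺} (v(t+h)-v(t))/h`. -/
def DiniUpper (v : ℝ → ℝ) (t : ℝ) : EReal :=
  Filter.limsup (fun h => (((v (t + h) - v t) / h : ℝ) : EReal)) (nhdsWithin 0 (Ioi 0))

/-- Class `K∞` functions (on `[0,∞)`). -/
def IsKInf (a : ℝ → ℝ) : Prop :=
  ContinuousOn a (Ici 0) ∧ StrictMonoOn a (Ici 0) ∧ a 0 = 0 ∧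
  (∀ s, 0 ≤ s → 0 ≤ a s) ∧ Filter.Tendsto a Filter.atTop Filter.atTop

/-- Class `K⁺`: positive continuous functions on `[0,∞)`. -/
def IsKPlus (b : ℝ → ℝ) : Prop :=
  ContinuousOn b (Ici 0) ∧ ∀ t, 0 ≤ t → 0 < b t

/-- Class `KL` functions. -/
def IsKL (σ : ℝ → ℝ → ℝ) : Prop :=
  ContinuousOn (fun p : ℝ × ℝ => σ p.1 p.2) (Ici 0 ×ˢ Ici 0) ∧
  (∀ s t, 0 ≤ s → 0 ≤ t → 0 ≤ σ s t) ∧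
  (∀ t, 0 ≤ t → StrictMonoOn (fun s => σ s t) (Ici 0) ∧ σ 0 t = 0) ∧
  (∀ s, 0 ≤ s → AntitoneOn (σ s) (Ici 0)) ∧
  (∀ s, 0 ≤ s → Filter.Tendsto (σ s) Filter.atTop (nhds 0))

/-- Hypothesis (H1): a one-sided Lipschitz estimate. -/
def H1 (n l : ℕ) (r : ℝ) (D : Set (Euc l)) (f : ℝ → (ℝ → Euc n) → Euc l → Euc n) : Prop :=
  ∃ L : ℝ → ℝ → ℝ,
    ContinuousOn (fun p : ℝ × ℝ => L p.1 p.2) (Ici 0 ×ˢ Ici 0) ∧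
    (∀ t, 0 ≤ t → MonotoneOn (L t) (Ici 0)) ∧
    (∀ s, 0 ≤ s → MonotoneOn (fun t => L t s) (Ici 0)) ∧
    (∀ t s, 0 ≤ t → 0 ≤ s → 0 ≤ L t s) ∧
    ∀ t x y d, 0 ≤ t → ContinuousOn x (Icc (-r) 0) → ContinuousOn y (Icc (-r) 0) → d ∈ D →
      (inner ℝ (x 0 - y 0) (f t x d - f t y d) : ℝ) ≤
        L t (histNorm n r x + histNorm n r y) * (histNorm n r (x - y))^2

/-- Hypothesis (H2): `f` maps bounded sets to bounded sets, uniformly in `d ∈ D`. -/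
def H2 (n l : ℕ) (r : ℝ) (D : Set (Euc l)) (f : ℝ → (ℝ → Euc n) → Euc l → Euc n) : Prop :=
  ∀ Tb Rb : ℝ, ∃ C : ℝ, ∀ t x d, 0 ≤ t → t ≤ Tb → ContinuousOn x (Icc (-r) 0) →
    histNorm n r x ≤ Rb → d ∈ D → ‖f t x d‖ ≤ C

/-- Hypothesis (H3): continuity off a countable exceptional set of times with no finite
accumulation point, plus right-continuity in time everywhere. -/
def H3 (n l : ℕ) (r : ℝ) (D : Set (Euc l)) (f : ℝ → (ℝ → Euc n) → Euc l → Euc n) : Prop :=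
  ∃ A : Set ℝ, (∀ C : ℝ, (A ∩ Icc 0 C).Finite) ∧
    (∀ t x d, 0 ≤ t → t ∉ A → ContinuousOn x (Icc (-r) 0) → d ∈ D →
      ∀ ε > 0, ∃ δ > 0, ∀ t' x' d', 0 ≤ t' → ContinuousOn x' (Icc (-r) 0) → d' ∈ D →
        |t' - t| < δ → histNorm n r (x' - x) < δ → ‖d' - d‖ < δ →
          ‖f t' x' d' - f t x d‖ < ε) ∧
    (∀ t x d, 0 ≤ t → ContinuousOn x (Icc (-r) 0) → d ∈ D →
      ∀ ε > 0, ∃ δ > 0, ∀ t', t ≤ t' → t' - t < δ → ‖f t' x d - f t x d‖ < ε)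

/-- Hypothesis (H4). -/
def H4 (n l : ℕ) (r : ℝ) (D : Set (Euc l)) (f : ℝ → (ℝ → Euc n) → Euc l → Euc n) : Prop :=
  ∀ ε > 0, ∀ t, 0 ≤ t → ∃ δ > 0, ∀ τ x d, 0 ≤ τ → d ∈ D → ContinuousOn x (Icc (-r) 0) →
    |τ - t| + histNorm n r x < δ → ‖f τ x d‖ < ε

/-- A solution of the RFDE on `[t₀ - r, T)` (continuous, absolutely continuous on compact
subintervals of `[t₀,T)` and satisfying the equation a.e., expressed in integral form). -/
def IsSolIco (n l : ℕ) (r : ℝ) (f : ℝ → (ℝ → Euc n) → Euc l → Euc n) (d : ℝ → Euc l)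
    (t₀ T : ℝ) (x : ℝ → Euc n) : Prop :=
  ContinuousOn x (Ico (t₀ - r) T) ∧
  ∀ t ∈ Ico t₀ T,
    IntervalIntegrable (fun s => f s (fun θ => x (s + θ)) (d s)) volume t₀ t ∧
    x t = x t₀ + ∫ s in t₀..t, f s (fun θ => x (s + θ)) (d s)

/-- A solution of the RFDE on all of `[t₀ - r, ∞)`. -/
def IsSolGlobal (n l : ℕ) (r : ℝ) (f : ℝ → (ℝ → Euc n) → Euc l → Euc n) (d : ℝ → Euc l)
    (t₀ : ℝ) (x : ℝ → Euc n) : Prop :=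
  ContinuousOn x (Ici (t₀ - r)) ∧
  ∀ t, t₀ ≤ t →
    IntervalIntegrable (fun s => f s (fun θ => x (s + θ)) (d s)) volume t₀ t ∧
    x t = x t₀ + ∫ s in t₀..t, f s (fun θ => x (s + θ)) (d s)

/-- Non-uniform in time robust global asymptotic stability of `0` for the RFDE:
every maximal solution is defined on `[t₀,∞)` and satisfies the `KL` estimate (2.6). -/
def RGASnu (n l : ℕ) (r : ℝ) (D : Set (Euc l))
    (f : ℝ → (ℝ → Euc n) → Euc l → Euc n) : Prop :=
  ∃ σ : ℝ → ℝ → ℝ, ∃ β : ℝ → ℝ, IsKL σ ∧ IsKPlus β ∧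
    (∀ t₀ x₀ d, 0 ≤ t₀ → ContinuousOn x₀ (Icc (-r) 0) → MD l D d →
      ∃ x : ℝ → Euc n, IsSolGlobal n l r f d t₀ x ∧ ∀ θ ∈ Icc (-r) 0, x (t₀ + θ) = x₀ θ) ∧
    (∀ t₀ x₀ d x, 0 ≤ t₀ → ContinuousOn x₀ (Icc (-r) 0) → MD l D d →
      IsSolGlobal n l r f d t₀ x → (∀ θ ∈ Icc (-r) 0, x (t₀ + θ) = x₀ θ) →
      ∀ t, t₀ ≤ t →
        histNorm n r (fun θ => x (t + θ)) ≤ σ (β t₀ * histNorm n r x₀) (t - t₀))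

/-- Uniform robust global asymptotic stability of `0` for the RFDE. -/
def URGAS (n l : ℕ) (r : ℝ) (D : Set (Euc l))
    (f : ℝ → (ℝ → Euc n) → Euc l → Euc n) : Prop :=
  ∃ σ : ℝ → ℝ → ℝ, IsKL σ ∧
    (∀ t₀ x₀ d, 0 ≤ t₀ → ContinuousOn x₀ (Icc (-r) 0) → MD l D d →
      ∃ x : ℝ → Euc n, IsSolGlobal n l r f d t₀ x ∧ ∀ θ ∈ Icc (-r) 0, x (t₀ + θ) = x₀ θ) ∧
    (∀ t₀ x₀ d x, 0 ≤ t₀ → ContinuousOn x₀ (Icc (-r) 0) → MD l D d →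
      IsSolGlobal n l r f d t₀ x → (∀ θ ∈ Icc (-r) 0, x (t₀ + θ) = x₀ θ) →
      ∀ t, t₀ ≤ t →
        histNorm n r (fun θ => x (t + θ)) ≤ σ (histNorm n r x₀) (t - t₀))

open scoped Topology

theorem aestronglyMeasurable_of_continuousAt_off_countable {E : Type*} [NormedAddCommGroup E]
    {g : ℝ → E} {B : Set ℝ} (hB : B.Countable) (hg : ∀ s ∉ B, ContinuousAt g s) :
    AEStronglyMeasurable g volume := by
  have h : AEStronglyMeasurable g (volume.restrict Bᶜ) :=
    ContinuousOn.aestronglyMeasurable (fun s hs => (hg s hs).continuousWithinAt)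
      hB.measurableSet.compl
  rwa [Measure.restrict_eq_self_of_ae_mem] at h
  exact hB.ae_notMem volume

theorem intervalIntegrable_of_continuousAt_off_countable {E : Type*} [NormedAddCommGroup E]
    {g : ℝ → E} {B : Set ℝ} (hB : B.Countable) (hg : ∀ s ∉ B, ContinuousAt g s)
    {C : ℝ → ℝ} (hC : ∀ T, ∀ s ≤ T, ‖g s‖ ≤ C T) (a b : ℝ) :
    IntervalIntegrable g volume a b := by
  refine (intervalIntegrable_const (c := C (max a b))).mono_fun
    (aestronglyMeasurable_of_continuousAt_off_countable hB hg).restrict ?_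
  refine (ae_restrict_iff' measurableSet_uIoc).2 (Eventually.of_forall fun s hs => ?_)
  exact (hC _ s hs.2).trans (le_abs_self _)

/-- Translation of a continuous path to the right by `η`. -/
def shiftPath {E : Type*} [TopologicalSpace E] (η : ℝ) (x : C(ℝ, E)) : C(ℝ, E) :=
  ⟨fun u => x (u - η), by fun_prop⟩

theorem continuous_shiftPath {E : Type*} [TopologicalSpace E] :
    Continuous fun p : ℝ × C(ℝ, E) => shiftPath p.1 p.2 := by
  refine ContinuousMap.continuous_of_continuous_uncurry _ ?_
  simp only [shiftPath, ContinuousMap.coe_mk, Function.uncurry_def]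
  fun_prop

/-- The paths issuing from `ψ t₀` whose increments are controlled by those of `ψ` and by the
rates `C T` on `(-∞, T]` form a compact set. -/
theorem isCompact_setOf_increment_le {E : Type*} [NormedAddCommGroup E] [ProperSpace E]
    (t₀ : ℝ) (ψ : C(ℝ, E)) (C : ℝ → ℝ) :
    IsCompact {y : C(ℝ, E) | y t₀ = ψ t₀ ∧
      ∀ T, ∀ t ≤ T, ∀ t' ≤ T, ‖y t - y t'‖ ≤ ‖ψ t - ψ t'‖ + C T * |t - t'|} := by
  have key : ∀ y : ℝ → E, (∀ T, ∀ t ≤ T, ∀ t' ≤ T,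
      ‖y t - y t'‖ ≤ ‖ψ t - ψ t'‖ + C T * |t - t'|) → ∀ t, ∀ t' ≤ t + 1,
      dist (y t) (y t') ≤ ‖ψ t - ψ t'‖ + C (t + 1) * |t - t'| := fun y hy t t' ht' => by
    rw [dist_eq_norm]
    exact hy (t + 1) t (by linarith) t' ht'
  have hlim : ∀ t, Tendsto (fun t' => ‖ψ t - ψ t'‖ + C (t + 1) * |t - t'|) (𝓝 t) (𝓝 0) := by
    intro t
    have : Continuous fun t' => ‖ψ t - ψ t'‖ + C (t + 1) * |t - t'| := by fun_prop
    simpa using this.tendsto t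
  have hnear : ∀ t : ℝ, ∀ᶠ t' in 𝓝 t, t' ≤ t + 1 := fun t =>
    (eventually_lt_nhds (by linarith)).mono fun _ h => h.le
  refine ArzelaAscoli.isCompact_of_equicontinuous _ ?_ ?_
  · have himg : ContinuousMap.toFun '' {y : C(ℝ, E) | y t₀ = ψ t₀ ∧
        ∀ T, ∀ t ≤ T, ∀ t' ≤ T, ‖y t - y t'‖ ≤ ‖ψ t - ψ t'‖ + C T * |t - t'|} =
        {y : ℝ → E | y t₀ = ψ t₀ ∧
        ∀ T, ∀ t ≤ T, ∀ t' ≤ T, ‖y t - y t'‖ ≤ ‖ψ t - ψ t'‖ + C T * |t - t'|} := by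
      ext y
      constructor
      · rintro ⟨z, hz, rfl⟩
        exact hz
      · intro hy
        refine ⟨⟨y, continuous_iff_continuousAt.2 fun t => ?_⟩, hy, rfl⟩
        refine tendsto_iff_dist_tendsto_zero.2 ?_
        refine squeeze_zero' (Eventually.of_forall fun _ => dist_nonneg) ?_ (hlim t)
        filter_upwards [hnear t] with t' ht'
        rw [dist_comm]
        exact key y hy.2 t t' ht'
    rw [himg]
    refine IsCompact.of_isClosed_subset (isCompact_univ_pi fun t => isCompact_closedBall (ψ t₀)
      (‖ψ t - ψ t₀‖ + C (max t t₀) * |t - t₀|)) ?_ ?_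
    · simp only [ofPred_and, ofPred_forall]
      refine (isClosed_eq (by fun_prop) (by fun_prop)).inter ?_
      refine isClosed_iInter fun T => isClosed_iInter fun t => isClosed_iInter fun _ =>
        isClosed_iInter fun t' => isClosed_iInter fun _ => isClosed_le (by fun_prop) (by fun_prop)
    · intro y hy t _
      rw [Metric.mem_closedBall, dist_eq_norm, ← hy.1]
      have := hy.2 (max t t₀) t (le_max_left _ _) t₀ (le_max_right _ _)
      rwa [← hy.1] at this
  · intro t
    rw [Metric.equicontinuousAt_iff_right]
    intro ε hε
    filter_upwards [hnear t, (hlim t).eventually_lt_const hε] with t' ht' hlt y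
    exact (key y.1 y.2.2 t t' ht').trans_lt hlt

/-- Peano existence for causal functional equations
`x t = ψ t + ∫ s in t₀..t, F s x` with locally bounded right-hand side that is jointly continuous
away from a countable set of times. -/
theorem exists_integral_solution {E : Type*} [NormedAddCommGroup E] [NormedSpace ℝ E]
    [ProperSpace E] (F : ℝ → C(ℝ, E) → E) (t₀ : ℝ) (ψ : C(ℝ, E)) {B : Set ℝ} (hB : B.Countable)
    (hcont : ∀ s ∉ B, ∀ x, ContinuousAt (Function.uncurry F) (s, x))
    (hcausal : ∀ s ∉ B, ∀ x y : C(ℝ, E), (∀ u ≤ s, x u = y u) → F s x = F s y)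
    (hzero : ∀ s ≤ t₀, ∀ x, F s x = 0)
    (C : ℝ → ℝ) (hC : ∀ T, ∀ s ≤ T, ∀ x, ‖F s x‖ ≤ C T) :
    ∃ x : C(ℝ, E), ∀ t, x t = ψ t + ∫ s in t₀..t, F s x := by
  have hcurve : ∀ x : C(ℝ, E), ∀ s ∉ B, ContinuousAt (fun s => F s x) s := fun x s hs =>
    ContinuousAt.comp (f := fun s => (s, x)) (hcont s hs x) (by fun_prop)
  have hint : ∀ (x : C(ℝ, E)) a b, IntervalIntegrable (fun s => F s x) volume a b := fun x =>
    intervalIntegrable_of_continuousAt_off_countable hB (hcurve x) fun T s hs => hC T s hs x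
  let Φ : ℝ → C(ℝ, E) → C(ℝ, E) := fun η x =>
    ⟨fun t => ψ t + ∫ s in t₀..t, F s (shiftPath η x),
      ψ.continuous.add (intervalIntegral.continuous_primitive (hint _) t₀)⟩
  have hΦ : ∀ η x t, Φ η x t = ψ t + ∫ s in t₀..t, F s (shiftPath η x) := fun _ _ _ => rfl
  have hagree : ∀ η : ℝ, 0 < η → ∀ m : ℕ, ∀ u ≤ t₀ + m * η,
      (Φ η)^[m + 1] ψ u = (Φ η)^[m] ψ u := by
    intro η hη m
    induction m with
    | zero =>
      intro u hu
      have hu : u ≤ t₀ := by simpa using hu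
      have : ∫ s in t₀..u, F s (shiftPath η ψ) = 0 := by
        refine intervalIntegral.integral_zero_ae (Eventually.of_forall fun s hs => ?_)
        rw [uIoc_of_ge hu] at hs
        exact hzero s hs.2 _
      simp [hΦ, this]
    | succ m ih =>
      intro u hu
      rw [Function.iterate_succ_apply', Function.iterate_succ_apply' _ m, hΦ, hΦ]
      congr 1
      refine intervalIntegral.integral_congr_ae ?_
      filter_upwards [hB.ae_notMem volume] with s hsB hs
      rcases le_or_gt s t₀ with h | h
      · rw [hzero s h, hzero s h]
      · refine hcausal s hsB _ _ fun w hw => ?_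
        have hsu : s ≤ u := by
          rcases le_max_iff.1 hs.2 with h' | h'
          · exact absurd h' (not_le.2 h)
          · exact h'
        push_cast at hu
        have := ih (w - η) (by linarith)
        rwa [Function.iterate_succ_apply'] at this
  let η : ℕ → ℝ := fun k => 1 / ((k : ℝ) + 1)
  have hη : ∀ k, 0 < η k := fun k => by positivity
  let y : ℕ → C(ℝ, E) := fun k => (Φ (η k))^[(k + 1) * (k + 1)] ψ
  let x : ℕ → C(ℝ, E) := fun k => Φ (η k) (y k)
  have hxy : ∀ k : ℕ, ∀ u ≤ t₀ + k, x k u = y k u := by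
    intro k u hu
    have := hagree (η k) (hη k) ((k + 1) * (k + 1)) u (by
      have : (((k + 1) * (k + 1) : ℕ) : ℝ) * η k = k + 1 := by
        simp only [η]; push_cast; field_simp
      rw [this]; linarith)
    rwa [Function.iterate_succ_apply'] at this
  have hmem : ∀ k, x k ∈ {y : C(ℝ, E) | y t₀ = ψ t₀ ∧
      ∀ T, ∀ t ≤ T, ∀ t' ≤ T, ‖y t - y t'‖ ≤ ‖ψ t - ψ t'‖ + C T * |t - t'|} := by
    intro k
    refine ⟨by simp [x, hΦ], fun T t ht t' ht' => ?_⟩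
    have h1 : x k t - x k t' =
        (ψ t - ψ t') + ∫ s in t'..t, F s (shiftPath (η k) (y k)) := by
      rw [← intervalIntegral.integral_interval_sub_left (hint _ t₀ t) (hint _ t₀ t')]
      simp only [x, hΦ]
      abel
    rw [h1]
    refine (norm_add_le _ _).trans (add_le_add le_rfl ?_)
    exact intervalIntegral.norm_integral_le_of_norm_le_const fun s hs =>
      hC T s (hs.2.trans (max_le ht' ht)) _
  obtain ⟨z, -, φ, hφ, hlim⟩ := (isCompact_setOf_increment_le t₀ ψ C).tendsto_subseq hmem
  refine ⟨z, fun t => ?_⟩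
  have hη0 : Tendsto (fun k => η (φ k)) atTop (𝓝 0) :=
    (tendsto_one_div_add_atTop_nhds_zero_nat (𝕜 := ℝ)).comp hφ.tendsto_atTop
  have hshift : Tendsto (fun k => shiftPath (η (φ k)) (x (φ k))) atTop (𝓝 z) := by
    have h0 : shiftPath 0 z = z := by ext u; simp [shiftPath]
    have := (continuous_shiftPath (E := E)).tendsto (0, z)
    rw [h0] at this
    exact this.comp (hη0.prodMk_nhds hlim)
  have hconv : Tendsto (fun k => ∫ s in t₀..t, F s (shiftPath (η (φ k)) (x (φ k)))) atTop
      (𝓝 (∫ s in t₀..t, F s z)) := by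
    refine intervalIntegral.tendsto_integral_filter_of_dominated_convergence
      (fun _ => C (max t₀ t)) (Eventually.of_forall fun k => ?_)
      (Eventually.of_forall fun k => Eventually.of_forall fun s hs => hC _ s hs.2 _)
      intervalIntegrable_const ?_
    · exact (aestronglyMeasurable_of_continuousAt_off_countable hB (hcurve _)).restrict
    · filter_upwards [hB.ae_notMem volume] with s hs _
      exact (hcont s hs z).tendsto.comp (tendsto_const_nhds.prodMk_nhds hshift)
  have hpt : Tendsto (fun k => x (φ k) t) atTop (𝓝 (z t)) :=
    ((continuous_eval_const t).tendsto z).comp hlim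
  refine tendsto_nhds_unique hpt ((tendsto_const_nhds.add hconv).congr' ?_)
  have hlarge : ∀ᶠ k in atTop, t ≤ t₀ + (φ k : ℝ) := by
    have : Tendsto (fun k => (φ k : ℝ)) atTop atTop :=
      tendsto_natCast_atTop_atTop.comp hφ.tendsto_atTop
    filter_upwards [this.eventually_ge_atTop (t - t₀)] with k hk
    linarith
  filter_upwards [hlarge] with k hk
  change _ = Φ (η (φ k)) (y (φ k)) t
  rw [hΦ]
  congr 1
  refine intervalIntegral.integral_congr_ae ?_
  filter_upwards [hB.ae_notMem volume] with s hsB hs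
  rcases le_or_gt s t₀ with h | h
  · rw [hzero s h, hzero s h]
  · refine hcausal s hsB _ _ fun w hw => hxy _ _ ?_
    have hst : s ≤ t := by
      rcases le_max_iff.1 hs.2 with h' | h'
      · exact absurd h' (not_le.2 h)
      · exact h'
    linarith [hη (φ k)]

theorem le_histNorm {n : ℕ} {q : ℝ} {y : ℝ → Euc n} (hy : ContinuousOn y (Icc (-q) 0)) {θ : ℝ}
    (hθ : θ ∈ Icc (-q) 0) : ‖y θ‖ ≤ histNorm n q y :=
  le_csSup (isCompact_Icc.bddAbove_image hy.norm) (mem_image_of_mem _ hθ)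

theorem histNorm_le {n : ℕ} {q : ℝ} (hq : 0 ≤ q) {y : ℝ → Euc n} {c : ℝ}
    (h : ∀ θ ∈ Icc (-q) 0, ‖y θ‖ ≤ c) : histNorm n q y ≤ c := by
  refine csSup_le ((nonempty_Icc.2 (by linarith)).image _) ?_
  rintro _ ⟨θ, hθ, rfl⟩
  exact h θ hθ

theorem histNorm_nonneg {n : ℕ} {q : ℝ} (y : ℝ → Euc n) : 0 ≤ histNorm n q y := by
  refine Real.sSup_nonneg ?_
  rintro _ ⟨θ, -, rfl⟩
  exact norm_nonneg _

theorem histNorm_congr {n : ℕ} {q : ℝ} {x y : ℝ → Euc n} (h : EqOn x y (Icc (-q) 0)) :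
    histNorm n q x = histNorm n q y := by
  unfold histNorm
  congr 1
  exact image_congr fun θ hθ => by rw [h hθ]

theorem histNorm_sub_eq_zero {n : ℕ} {q : ℝ} (hq : 0 ≤ q) {x y : ℝ → Euc n}
    (h : EqOn x y (Icc (-q) 0)) : histNorm n q (x - y) = 0 :=
  le_antisymm (histNorm_le hq fun θ hθ => by simp [h hθ]) (histNorm_nonneg _)

/-- The history segment on `[-q, 0]` of a path at time `s`, as a bundled continuous map. -/
def histSegment {n : ℕ} (q s : ℝ) (x : C(ℝ, Euc n)) : C(Icc (-q) 0, Euc n) :=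
  ⟨fun θ => x (s + θ), by fun_prop⟩

theorem continuous_histSegment {n : ℕ} (q : ℝ) :
    Continuous fun p : ℝ × C(ℝ, Euc n) => histSegment q p.1 p.2 := by
  refine ContinuousMap.continuous_of_continuous_uncurry _ ?_
  simp only [histSegment, ContinuousMap.coe_mk, Function.uncurry_def]
  fun_prop

theorem histNorm_eq_norm_histSegment {n : ℕ} {q : ℝ} (hq : 0 ≤ q) (s : ℝ) (x : C(ℝ, Euc n)) :
    histNorm n q (fun θ => x (s + θ)) = ‖histSegment q s x‖ := by
  refine le_antisymm (histNorm_le hq fun θ hθ => ?_) ?_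
  · exact (histSegment q s x).norm_coe_le_norm ⟨θ, hθ⟩
  · refine (ContinuousMap.norm_le _ (histNorm_nonneg _)).2 fun θ => ?_
    exact le_histNorm (y := fun θ => x (s + θ)) (by fun_prop) θ.2

theorem histNorm_sub_eq_dist_histSegment {n : ℕ} {q : ℝ} (hq : 0 ≤ q) (s s' : ℝ)
    (x x' : C(ℝ, Euc n)) :
    histNorm n q ((fun θ => x' (s' + θ)) - fun θ => x (s + θ)) =
      dist (histSegment q s' x') (histSegment q s x) := by
  rw [dist_eq_norm]
  refine le_antisymm (histNorm_le hq fun θ hθ => ?_) ?_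
  · exact (histSegment q s' x' - histSegment q s x).norm_coe_le_norm ⟨θ, hθ⟩
  · refine (ContinuousMap.norm_le _ (histNorm_nonneg _)).2 fun θ => ?_
    exact le_histNorm (y := (fun θ => x' (s' + θ)) - fun θ => x (s + θ)) (by fun_prop) θ.2

theorem continuous_histNorm {n : ℕ} {q : ℝ} (hq : 0 ≤ q) :
    Continuous fun p : ℝ × C(ℝ, Euc n) => histNorm n q fun θ => p.2 (p.1 + θ) := by
  simp only [histNorm_eq_norm_histSegment hq]
  exact (continuous_histSegment q).norm

theorem tendsto_histNorm_sub {n : ℕ} {q : ℝ} (hq : 0 ≤ q) (s : ℝ) (x : C(ℝ, Euc n)) :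
    Tendsto (fun p : ℝ × C(ℝ, Euc n) =>
      histNorm n q ((fun θ => p.2 (p.1 + θ)) - fun θ => x (s + θ))) (𝓝 (s, x)) (𝓝 0) := by
  simp only [histNorm_sub_eq_dist_histSegment hq]
  exact tendsto_iff_dist_tendsto_zero.1 ((continuous_histSegment q).tendsto (s, x))

/-- The right-hand side along a path, multiplied by a cut-off of the norm of the history and set
to zero up to the initial time. -/
def cutoffField {n l : ℕ} (r : ℝ) (f : ℝ → (ℝ → Euc n) → Euc l → Euc n) (d : ℝ → Euc l)
    (χ : ℝ → ℝ) (t₀ s : ℝ) (x : C(ℝ, Euc n)) : Euc n :=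
  open Classical in
  if t₀ < s then χ (histNorm n r fun θ => x (s + θ)) • f s (fun θ => x (s + θ)) (d s) else 0

theorem cutoffField_of_lt {n l : ℕ} {r : ℝ} {f : ℝ → (ℝ → Euc n) → Euc l → Euc n}
    {d : ℝ → Euc l} {χ : ℝ → ℝ} {t₀ s : ℝ} (h : t₀ < s) (x : C(ℝ, Euc n)) :
    cutoffField r f d χ t₀ s x =
      χ (histNorm n r fun θ => x (s + θ)) • f s (fun θ => x (s + θ)) (d s) := if_pos h

theorem cutoffField_of_le {n l : ℕ} {r : ℝ} {f : ℝ → (ℝ → Euc n) → Euc l → Euc n}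
    {d : ℝ → Euc l} {χ : ℝ → ℝ} {t₀ s : ℝ} (h : s ≤ t₀) (x : C(ℝ, Euc n)) :
    cutoffField r f d χ t₀ s x = 0 := if_neg (not_lt.2 h)

/-- Outside a locally finite set of times the right-hand side is jointly continuous along paths
and depends only on the history segment. -/
theorem exists_regular_times {n l : ℕ} {r : ℝ} (hr : 0 ≤ r) {D : Set (Euc l)}
    {f : ℝ → (ℝ → Euc n) → Euc l → Euc n} (h3 : H3 n l r D f) {d : ℝ → Euc l} (hd : MD l D d)
    {t₀ : ℝ} (ht₀ : 0 ≤ t₀) :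
    ∃ B : Set ℝ, (∀ c, (B ∩ Icc 0 c).Finite) ∧ B.Countable ∧
      (∀ χ : ℝ → ℝ, Continuous χ → ∀ s ∉ B, ∀ x : C(ℝ, Euc n),
        ContinuousAt (Function.uncurry (cutoffField r f d χ t₀)) (s, x)) ∧
      ∀ s, t₀ < s → s ∉ B → ∀ x y : ℝ → Euc n, ContinuousOn x (Icc (-r) 0) →
        ContinuousOn y (Icc (-r) 0) → EqOn x y (Icc (-r) 0) → f s x (d s) = f s y (d s) := by
  obtain ⟨A, hA, hfc, -⟩ := h3
  obtain ⟨hdD, -, A', hA', hdc⟩ := hd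
  have hfin : ∀ c, ((((A ∪ A') ∩ Ici 0) ∪ {t₀}) ∩ Icc 0 c).Finite := fun c =>
    (((hA c).union (hA' c)).union (finite_singleton t₀)).subset (by
      rintro s ⟨⟨hs | hs, -⟩ | hs, hc⟩
      exacts [.inl (.inl ⟨hs, hc⟩), .inl (.inr ⟨hs, hc⟩), .inr hs])
  refine ⟨((A ∪ A') ∩ Ici 0) ∪ {t₀}, hfin, ?_, ?_, ?_⟩
  · refine (countable_iUnion fun k : ℕ => (hfin (k + t₀)).countable).mono fun s hs => ?_
    have hs0 : 0 ≤ s := by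
      rcases hs with hs | hs
      · exact hs.2
      · rw [mem_singleton_iff.1 hs]; exact ht₀
    obtain ⟨k, hk⟩ := exists_nat_ge s
    exact mem_iUnion.2 ⟨k, hs, hs0, by linarith⟩
  · intro χ hχ s hs x
    have hst : s ≠ t₀ := fun h => hs (.inr h)
    rcases lt_or_gt_of_ne hst with h | h
    · refine (continuousAt_const (y := (0 : Euc n))).congr ?_
      have : ∀ᶠ p : ℝ × C(ℝ, Euc n) in 𝓝 (s, x), p.1 < t₀ :=
        continuous_fst.continuousAt.eventually_lt_const h
      filter_upwards [this] with p hp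
      exact (cutoffField_of_le hp.le _).symm
    · have hs0 : 0 < s := ht₀.trans_lt h
      have hpos : ∀ᶠ p : ℝ × C(ℝ, Euc n) in 𝓝 (s, x), t₀ < p.1 :=
        continuous_fst.continuousAt.eventually_const_lt h
      have hsA : s ∉ A := fun h => hs (.inl ⟨.inl h, hs0.le⟩)
      have hsA' : s ∉ A' := fun h => hs (.inl ⟨.inr h, hs0.le⟩)
      have hf : ContinuousAt
          (fun p : ℝ × C(ℝ, Euc n) => f p.1 (fun θ => p.2 (p.1 + θ)) (d p.1)) (s, x) := by
        refine Metric.tendsto_nhds.2 fun ε hε => ?_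
        obtain ⟨δ, hδ, H⟩ := hfc s (fun θ => x (s + θ)) (d s) hs0.le hsA
          (by fun_prop) (hdD s hs0.le) ε hε
        obtain ⟨δ', hδ', H'⟩ := hdc s hs0.le hsA' δ hδ
        have hnear : ∀ᶠ p : ℝ × C(ℝ, Euc n) in 𝓝 (s, x), |p.1 - s| < min δ δ' :=
          continuous_fst.tendsto (s, x) (Metric.ball_mem_nhds s (lt_min hδ hδ'))
        filter_upwards [hpos, hnear, (tendsto_histNorm_sub hr s x).eventually_lt_const hδ]
          with p hp hp1 hp2
        rw [dist_eq_norm]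
        have hp0 : 0 ≤ p.1 := ht₀.trans hp.le
        exact H p.1 _ _ hp0 (by fun_prop) (hdD _ hp0) (hp1.trans_le (min_le_left _ _)) hp2
          (H' _ hp0 (hp1.trans_le (min_le_right _ _)))
      refine (((hχ.comp (continuous_histNorm hr)).continuousAt).smul hf).congr ?_
      filter_upwards [hpos] with p hp
      exact (cutoffField_of_lt hp _).symm
  · intro s hst hs x y hx hy hxy
    have hs0 : 0 ≤ s := ht₀.trans hst.le
    refine eq_of_forall_dist_le fun ε hε => ?_
    obtain ⟨δ, hδ, H⟩ := hfc s y (d s) hs0 (fun h => hs (.inl ⟨.inl h, hs0⟩)) hy (hdD s hs0) ε hε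
    rw [dist_eq_norm]
    exact (H s x (d s) hs0 hx (hdD s hs0) (by simpa) (by rwa [histNorm_sub_eq_zero hr hxy])
      (by simpa)).le

theorem Eop_eq {n : ℕ} (x : ℝ → Euc n) (h : ℝ) (v : Euc n) :
    Eop n x h v = fun θ => x (min (θ + h) 0) + max (θ + h) 0 • v := by
  funext θ
  unfold Eop
  split_ifs with hθ
  · rw [min_eq_right (by linarith), max_eq_left (by linarith)]
  · rw [min_eq_left (by linarith), max_eq_right (by linarith), zero_smul, add_zero]

/-- Along a differentiable path the upper right Dini derivative of `V` is bounded by the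
generalized derivative of `V` in the direction of the velocity. -/
theorem eventually_slope_lt_of_Vdot_lt {n : ℕ} {r : ℝ} (hr : 0 ≤ r) {V : ℝ → (ℝ → Euc n) → ℝ}
    {x : C(ℝ, Euc n)} {t : ℝ} {w : Euc n} (hx : HasDerivAt x w t) {ρ : ℝ}
    (hρ : Vdot n r V t (fun θ => x (t + θ)) w < (ρ : EReal)) :
    ∀ᶠ z in 𝓝[>] t, slope (fun s => V s fun θ => x (s + θ)) t z < ρ := by
  obtain ⟨⟨δ, hδ⟩, hsup⟩ := iInf_lt_iff.1 hρ
  have hδ : 0 < δ := hδ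
  obtain ⟨ε, hε, hlin⟩ := Metric.eventually_nhds_iff.1
    ((hasDerivAt_iff_isLittleO.1 hx).def (half_pos hδ))
  filter_upwards [Ioo_mem_nhdsGT (show t < t + min δ ε by simp [hδ, hε])] with z hz
  obtain ⟨h, rfl⟩ : ∃ h, z = t + h := ⟨z - t, by ring⟩
  have hh : 0 < h := by linarith [hz.1]
  have hhδ : h < δ := by linarith [hz.2, min_le_left δ ε]
  have hhε : h < ε := by linarith [hz.2, min_le_right δ ε]
  set y : ℝ → Euc n := fun θ => h⁻¹ • (x (t + h + θ) - Eop n (fun θ => x (t + θ)) h w θ) with hy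
  have hyc : ContinuousOn y (Icc (-r) 0) := by
    simp only [hy, Eop_eq]
    fun_prop
  have hyn : histNorm n r y < δ := by
    refine (histNorm_le hr fun θ hθ => ?_).trans_lt (half_lt_self hδ)
    simp only [hy, Eop_eq, norm_smul, norm_inv, Real.norm_eq_abs, abs_of_pos hh]
    rw [inv_mul_le_iff₀ hh]
    rcases le_total (θ + h) 0 with h0 | h0
    · rw [min_eq_left h0, max_eq_right h0, add_assoc, add_comm h θ]
      simp only [zero_smul, add_zero, sub_self, norm_zero]
      positivity
    · rw [min_eq_right h0, max_eq_left h0]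
      have := hlin (y := t + h + θ) (by
        rw [Real.dist_eq, abs_of_nonneg] <;> linarith [hθ.2])
      have he : t + h + θ - t = θ + h := by ring
      rw [he, Real.norm_eq_abs, abs_of_nonneg h0] at this
      rw [add_zero, ← sub_sub]
      refine this.trans ?_
      rw [mul_comm h]
      exact mul_le_mul_of_nonneg_left (by linarith [hθ.2]) (half_pos hδ).le
  have hlt := (le_iSup (fun p : {p : ℝ × (ℝ → Euc n) //
      0 < p.1 ∧ p.1 < δ ∧ ContinuousOn p.2 (Icc (-r) 0) ∧ histNorm n r p.2 < δ} =>
      (((V (t + p.1.1) (fun θ => Eop n (fun θ => x (t + θ)) p.1.1 w θ + p.1.1 • p.1.2 θ) -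
        V t fun θ => x (t + θ)) / p.1.1 : ℝ) : EReal)) ⟨(h, y), hh, hhδ, hyc, hyn⟩).trans_lt hsup
  have hrec : (fun θ => Eop n (fun θ => x (t + θ)) h w θ + h • y θ) =
      fun θ => x (t + h + θ) := by
    funext θ
    simp only [hy]
    rw [smul_inv_smul₀ hh.ne', add_sub_cancel]
  rw [EReal.coe_lt_coe_iff] at hlt
  simp only [hrec] at hlt
  rw [slope_def_field]
  simpa using hlt

theorem le_mul_exp_of_frequently_slope_lt {v : ℝ → ℝ} {a b : ℝ} (hab : a ≤ b)
    (hv : ContinuousOn v (Icc a b))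
    (hslope : ∀ s ∈ Ico a b, ∀ ρ, -v s < ρ → ∃ᶠ z in 𝓝[>] s, slope v s z < ρ) :
    v b ≤ v a * Real.exp (a - b) := by
  refine le_of_forall_pos_le_add fun ε hε => ?_
  refine image_le_of_liminf_slope_right_lt_deriv_boundary' hv (f' := fun s => -v s) hslope
    (B := fun s => v a * Real.exp (a - s) + ε) (B' := fun s => -(v a * Real.exp (a - s)))
    (by simp [hε.le]) (by fun_prop) (fun s _ => ?_) (fun s _ hs => ?_) ⟨hab, le_rfl⟩
  · have h := (((hasDerivAt_id s).const_sub a).exp.const_mul (v a)).add_const ε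
    simpa using h.hasDerivWithinAt
  · simp only [hs]
    linarith

theorem continuousOn_along_path {n : ℕ} {r : ℝ} (hr : 0 ≤ r) {V : ℝ → (ℝ → Euc n) → ℝ}
    (hVcont : ∀ t x, 0 ≤ t → ContinuousOn x (Icc (-r) 0) → ∀ ε > 0, ∃ δ > 0,
      ∀ t' x', 0 ≤ t' → ContinuousOn x' (Icc (-r) 0) →
        |t' - t| + histNorm n r (x' - x) < δ → |V t' x' - V t x| < ε) (x : C(ℝ, Euc n)) :
    ContinuousOn (fun s => V s fun θ => x (s + θ)) (Ici 0) := by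
  intro s hs
  refine Metric.tendsto_nhds.2 fun ε hε => ?_
  obtain ⟨δ, hδ, H⟩ := hVcont s (fun θ => x (s + θ)) hs (by fun_prop) ε hε
  have h1 : Tendsto (fun s' => |s' - s| +
      histNorm n r ((fun θ => x (s' + θ)) - fun θ => x (s + θ))) (𝓝 s) (𝓝 (0 + 0)) := by
    refine Tendsto.add ?_ ?_
    · have : Continuous fun s' => |s' - s| := by fun_prop
      simpa using this.tendsto s
    · have h : Tendsto (fun s' : ℝ => (s', x)) (𝓝 s) (𝓝 (s, x)) :=
        tendsto_id.prodMk_nhds tendsto_const_nhds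
      have := (tendsto_histNorm_sub hr s x).comp h
      simpa only [Function.comp_def] using this
  rw [add_zero] at h1
  filter_upwards [self_mem_nhdsWithin, nhdsWithin_le_nhds (h1.eventually_lt_const hδ)]
    with s' hs' hlt
  exact H s' _ hs' (by fun_prop) hlt

/-- Exponential decay of `V` along a path which, outside a locally finite set of times and as long
as `V` stays below its initial value plus one, has an admissible velocity. -/
theorem decay_along_path {n : ℕ} {r : ℝ} (hr : 0 ≤ r) {V : ℝ → (ℝ → Euc n) → ℝ}
    (hVcont : ∀ t x, 0 ≤ t → ContinuousOn x (Icc (-r) 0) → ∀ ε > 0, ∃ δ > 0,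
      ∀ t' x', 0 ≤ t' → ContinuousOn x' (Icc (-r) 0) →
        |t' - t| + histNorm n r (x' - x) < δ → |V t' x' - V t x| < ε)
    (hVnn : ∀ t x, 0 ≤ t → ContinuousOn x (Icc (-r) 0) → 0 ≤ V t x)
    {x : C(ℝ, Euc n)} {t₀ : ℝ} (ht₀ : 0 ≤ t₀) {B : Set ℝ} (hB : ∀ c, (B ∩ Icc 0 c).Finite)
    {w : ℝ → Euc n}
    (hx : ∀ s, t₀ < s → s ∉ B → V s (fun θ => x (s + θ)) < V t₀ (fun θ => x (t₀ + θ)) + 1 →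
      HasDerivAt x (w s) s ∧
      Vdot n r V s (fun θ => x (s + θ)) (w s) ≤ ((-(V s fun θ => x (s + θ)) : ℝ) : EReal))
    {t : ℝ} (ht : t₀ ≤ t) :
    V t (fun θ => x (t + θ)) ≤ V t₀ (fun θ => x (t₀ + θ)) * Real.exp (t₀ - t) := by
  set v : ℝ → ℝ := fun s => V s fun θ => x (s + θ) with hv
  have hvc : ContinuousOn v (Ici 0) := continuousOn_along_path hr hVcont x
  have hv0 : 0 ≤ v t₀ := hVnn _ _ ht₀ (by fun_prop)
  have hsub : Icc t₀ t ⊆ Ici 0 := fun s hs => ht₀.trans hs.1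
  have hclosed : IsClosed ({s | v s ≤ v t₀ * Real.exp (t₀ - s)} ∩ Icc t₀ t) := by
    rw [inter_comm]
    exact isClosed_Icc.isClosed_le (hvc.mono hsub) (by fun_prop)
  refine hclosed.Icc_subset_of_forall_exists_gt (by simp) ?_ ⟨ht, le_rfl⟩
  rintro a ⟨ha : v a ≤ _, haI⟩ y (hy : a < y)
  have ha0 : 0 ≤ a := ht₀.trans haI.1
  have hlt : v a < v t₀ + 1 := by
    have : Real.exp (t₀ - a) ≤ 1 := Real.exp_le_one_iff.2 (by linarith [haI.1])
    nlinarith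
  have hfree : ∀ᶠ s in 𝓝[>] a, s ∉ B ∧ v s < v t₀ + 1 := by
    have h1 : ∀ᶠ s in 𝓝[>] a, s ∉ (B ∩ Icc 0 (a + 1)) \ {a} :=
      nhdsWithin_le_nhds (((hB (a + 1)).sdiff.isClosed.isOpen_compl).mem_nhds (by simp))
    have h2 : ∀ᶠ s in 𝓝[>] a, v s < v t₀ + 1 :=
      ((hvc a ha0).mono fun s (hs : a < s) => ha0.trans hs.le).eventually_lt_const hlt
    filter_upwards [h1, h2, Ioo_mem_nhdsGT (show a < a + 1 by linarith)] with s hs1 hs2 hs3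
    exact ⟨fun hsB => hs1 ⟨⟨hsB, by linarith [hs3.1], hs3.2.le⟩, hs3.1.ne'⟩, hs2⟩
  obtain ⟨c, hac, hc⟩ := (mem_nhdsGT_iff_exists_Ioo_subset).1 hfree
  have hac : a < c := hac
  obtain ⟨b, hab, hb⟩ := exists_between (lt_min hac hy)
  have hbc : b < c := hb.trans_le (min_le_left _ _)
  refine ⟨b, ?_, hab, hb.le.trans (min_le_right _ _)⟩
  have hstep : ∀ᶠ a' in 𝓝[>] a, v b ≤ v a' * Real.exp (a' - b) := by
    filter_upwards [Ioo_mem_nhdsGT hab] with a' ha'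
    refine le_mul_exp_of_frequently_slope_lt ha'.2.le
      (hvc.mono fun s hs => ha0.trans (ha'.1.le.trans hs.1)) fun s hs ρ hρ => ?_
    have has : a < s := ha'.1.trans_le hs.1
    obtain ⟨hsB, hsv⟩ := hc ⟨has, hs.2.trans hbc⟩
    obtain ⟨hd, hV⟩ := hx s (haI.1.trans_lt has) hsB hsv
    exact (eventually_slope_lt_of_Vdot_lt hr hd
      (hV.trans_lt (EReal.coe_lt_coe_iff.2 hρ))).frequently
  have hlim : Tendsto (fun a' => v a' * Real.exp (a' - b)) (𝓝[>] a)
      (𝓝 (v a * Real.exp (a - b))) := by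
    refine Tendsto.mul ((hvc a ha0).mono fun s (hs : a < s) => ha0.trans hs.le) ?_
    exact ((by fun_prop : Continuous fun a' => Real.exp (a' - b)).tendsto a).mono_left
      nhdsWithin_le_nhds
  calc v b ≤ v a * Real.exp (a - b) := ge_of_tendsto hlim hstep
    _ ≤ (v t₀ * Real.exp (t₀ - a)) * Real.exp (a - b) :=
        mul_le_mul_of_nonneg_right ha (Real.exp_pos _).le
    _ = v t₀ * Real.exp (t₀ - b) := by
        rw [mul_assoc, ← Real.exp_add]; ring_nf

theorem IsKInf.exists_inverse {a : ℝ → ℝ} (ha : IsKInf a) :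
    ∃ b : ℝ → ℝ, Continuous b ∧ StrictMono b ∧ b 0 = 0 ∧ ∀ s, 0 ≤ s → b (a s) = s := by
  obtain ⟨hc, hm, h0, hnn, htop⟩ := ha
  let g : ℝ → ℝ := fun s => a (max s 0) + min s 0
  have hgc : Continuous g :=
    (hc.comp_continuous (by fun_prop) fun s => le_max_right s 0).add (by fun_prop)
  have hgm : StrictMono g := by
    intro s t hst
    simp only [g]
    rcases le_total 0 s with hs | hs
    · rw [max_eq_left hs, max_eq_left (hs.trans hst.le), min_eq_right hs,
        min_eq_right (hs.trans hst.le)]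
      simpa using hm hs (hs.trans hst.le) hst
    · rw [max_eq_right hs, min_eq_left hs, h0]
      rcases le_or_gt t 0 with ht | ht
      · rw [max_eq_right ht, min_eq_left ht, h0]; linarith
      · rw [max_eq_left ht.le, min_eq_right ht.le]
        have := hm self_mem_Ici ht.le ht
        rw [h0] at this
        linarith
  have hg1 : Tendsto g atTop atTop := htop.congr' (by
    filter_upwards [eventually_ge_atTop 0] with s hs
    simp [g, hs])
  have hg2 : Tendsto g atBot atBot := tendsto_id.congr' (by
    filter_upwards [eventually_le_atBot 0] with s hs
    simp [g, hs, h0])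
  let e := hgm.orderIsoOfSurjective g (hgc.surjective hg1 hg2)
  have he : ∀ s, 0 ≤ s → e.symm (a s) = s := fun s hs => by
    rw [OrderIso.symm_apply_eq]
    simp [e, g, hs]
  exact ⟨e.symm, e.symm.continuous, e.symm.strictMono, by simpa [h0] using he 0 le_rfl, he⟩

theorem isKL_comp_exp {a b : ℝ → ℝ} (ha : IsKInf a) (hbc : Continuous b) (hbm : StrictMono b)
    (hb0 : b 0 = 0) : IsKL fun s t => b (a s * Real.exp (-t)) := by
  obtain ⟨hc, hm, h0, hnn, -⟩ := ha
  refine ⟨?_, fun s t hs _ => ?_, fun t _ => ⟨fun s hs s' hs' hss => ?_, by simp [h0, hb0]⟩,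
    fun s hs t _ t' _ htt => ?_, fun s hs => ?_⟩
  · refine hbc.comp_continuousOn (ContinuousOn.mul ?_ (by fun_prop))
    exact hc.comp continuousOn_fst fun p hp => hp.1
  · rw [← hb0]
    exact hbm.monotone (mul_nonneg (hnn s hs) (Real.exp_pos _).le)
  · exact hbm (mul_lt_mul_of_pos_right (hm hs hs' hss) (Real.exp_pos _))
  · exact hbm.monotone (mul_le_mul_of_nonneg_left (Real.exp_le_exp.2 (by linarith)) (hnn s hs))
  · have h : Tendsto (fun t => a s * Real.exp (-t)) atTop (𝓝 (a s * 0)) :=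
      (Real.tendsto_exp_neg_atTop_nhds_zero).const_mul _
    rw [mul_zero] at h
    simpa [hb0, Function.comp_def] using (hbc.tendsto 0).comp h

theorem hasDerivAt_of_eq_integral {E : Type*} [NormedAddCommGroup E] [NormedSpace ℝ E]
    [CompleteSpace E] {x g : ℝ → E} {t₀ : ℝ} {B : Set ℝ} (hB : B.Countable)
    (hg : ∀ s ∉ B, ContinuousAt g s) (hint : ∀ t, t₀ ≤ t → IntervalIntegrable g volume t₀ t)
    (hx : ∀ t, t₀ ≤ t → x t = x t₀ + ∫ s in t₀..t, g s) {s : ℝ} (hs : t₀ < s) (hsB : s ∉ B) :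
    HasDerivAt x (g s) s := by
  have h := (intervalIntegral.integral_hasDerivAt_right (hint s hs.le)
    (aestronglyMeasurable_of_continuousAt_off_countable hB hg).stronglyMeasurableAtFilter
    (hg s hsB)).const_add (x t₀)
  refine h.congr_of_eventuallyEq ?_
  filter_upwards [eventually_gt_nhds hs] with t ht
  exact hx t ht.le

/-- **Theorem 2.9, (b) ⇒ (a).** Under hypotheses (H1)-(H4), the existence of
a continuous Lyapunov functional `V` with bounds `a₁(‖x‖_r) ≤ V(t,x) ≤ a₂(β(t)‖x‖_r)`,
infinitesimal decrease `V⁰(t,x;f(t,x,d)) ≤ -V(t,x)`, and a local Lipschitz property,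
implies that `0` is non-uniformly in time RGAS. -/
theorem stmt7 (n l : ℕ) (r : ℝ) (hr : 0 ≤ r) (D : Set (Euc l)) (hD : D.Nonempty)
    (f : ℝ → (ℝ → Euc n) → Euc l → Euc n)
    (hf0 : ∀ t d, 0 ≤ t → d ∈ D → f t (fun _ => (0 : Euc n)) d = 0)
    (h1 : H1 n l r D f) (h2 : H2 n l r D f) (h3 : H3 n l r D f) (h4 : H4 n l r D f)
    (V : ℝ → (ℝ → Euc n) → ℝ)
    (hVcont : ∀ t x, 0 ≤ t → ContinuousOn x (Icc (-r) 0) → ∀ ε > 0, ∃ δ > 0,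
      ∀ t' x', 0 ≤ t' → ContinuousOn x' (Icc (-r) 0) →
        |t' - t| + histNorm n r (x' - x) < δ → |V t' x' - V t x| < ε)
    (hVnn : ∀ t x, 0 ≤ t → ContinuousOn x (Icc (-r) 0) → 0 ≤ V t x)
    (a₁ a₂ : ℝ → ℝ) (ha₁ : IsKInf a₁) (ha₂ : IsKInf a₂)
    (β : ℝ → ℝ) (hβ : IsKPlus β)
    (hbound : ∀ t x, 0 ≤ t → ContinuousOn x (Icc (-r) 0) →
      a₁ (histNorm n r x) ≤ V t x ∧ V t x ≤ a₂ (β t * histNorm n r x))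
    (hdecr : ∀ t x d, 0 ≤ t → ContinuousOn x (Icc (-r) 0) → d ∈ D →
      Vdot n r V t x (f t x d) ≤ ((-(V t x) : ℝ) : EReal))
    (M : ℝ → ℝ) (hMnn : ∀ R, 0 ≤ R → 0 ≤ M R) (hMmono : MonotoneOn M (Ici 0))
    (hVlip : ∀ R, 0 ≤ R → ∀ t x y, t ∈ Icc 0 R →
      ContinuousOn x (Icc (-r) 0) → ContinuousOn y (Icc (-r) 0) →
      histNorm n r x ≤ R → histNorm n r y ≤ R →
      |V t y - V t x| ≤ M R * histNorm n r (y - x)) :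
    RGASnu n l r D f := by
  obtain ⟨b, hbc, hbm, hb0, hba⟩ := ha₁.exists_inverse
  have decay : ∀ (t₀ : ℝ) (d : ℝ → Euc l) (χ : ℝ → ℝ) (x : C(ℝ, Euc n)), 0 ≤ t₀ → MD l D d →
      Continuous χ →
      (∀ t, t₀ ≤ t → IntervalIntegrable (fun s => cutoffField r f d χ t₀ s x) volume t₀ t ∧
        x t = x t₀ + ∫ s in t₀..t, cutoffField r f d χ t₀ s x) →
      (∀ s, t₀ < s → V s (fun θ => x (s + θ)) < V t₀ (fun θ => x (t₀ + θ)) + 1 →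
        χ (histNorm n r fun θ => x (s + θ)) = 1) →
      ∀ t, t₀ ≤ t →
        V t (fun θ => x (t + θ)) ≤ V t₀ (fun θ => x (t₀ + θ)) * Real.exp (t₀ - t) := by
    intro t₀ d χ x ht₀ hd hχ hx hχ1 t ht
    obtain ⟨B, hBfin, hBc, hcont, -⟩ := exists_regular_times hr h3 hd ht₀
    refine decay_along_path hr hVcont hVnn ht₀ hBfin
      (w := fun s => f s (fun θ => x (s + θ)) (d s)) (fun s hs hsB hsv => ⟨?_, ?_⟩) ht
    · have := hasDerivAt_of_eq_integral hBc
        (fun s hs => ContinuousAt.comp (f := fun s => (s, x)) (hcont χ hχ s hs x) (by fun_prop))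
        (fun t ht => (hx t ht).1) (fun t ht => (hx t ht).2) hs hsB
      simpa [Function.uncurry_def, cutoffField_of_lt hs, hχ1 s hs hsv] using this
    · have hs0 : 0 ≤ s := ht₀.trans hs.le
      exact hdecr s _ _ hs0 (by fun_prop) (hd.1 s hs0)
  refine ⟨fun s t => b (a₂ s * Real.exp (-t)), β, isKL_comp_exp ha₂ hbc hbm hb0, hβ, ?_, ?_⟩
  · intro t₀ x₀ d ht₀ hx₀ hd
    obtain ⟨B, -, hBc, hcont, hcongr⟩ := exists_regular_times hr h3 hd ht₀
    let ψ : C(ℝ, Euc n) := ⟨fun t => x₀ (max (-r) (min 0 (t - t₀))),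
      hx₀.comp_continuous (by fun_prop) fun t =>
        ⟨le_max_left _ _, max_le (by linarith) (min_le_left _ _)⟩⟩
    obtain ⟨N, hN0, hN⟩ : ∃ N, 0 ≤ N ∧ V t₀ (fun θ => ψ (t₀ + θ)) + 1 ≤ a₁ N :=
      ((eventually_ge_atTop 0).and (ha₁.2.2.2.2.eventually_ge_atTop _)).exists
    let χ : ℝ → ℝ := fun u => max 0 (min 1 (N + 1 - u))
    have hχ : Continuous χ := by fun_prop
    choose C hC using fun T => h2 T (N + 1)
    have hbd : ∀ T, ∀ s ≤ T, ∀ x, ‖cutoffField r f d χ t₀ s x‖ ≤ |C T| := fun T s hs x => by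
      rcases le_or_gt s t₀ with h | h
      · rw [cutoffField_of_le h, norm_zero]
        exact abs_nonneg _
      · have hχ0 : 0 ≤ χ (histNorm n r fun θ => x (s + θ)) := le_max_left _ _
        have hχ1 : χ (histNorm n r fun θ => x (s + θ)) ≤ 1 :=
          max_le zero_le_one (min_le_left _ _)
        rw [cutoffField_of_lt h, norm_smul, Real.norm_of_nonneg hχ0]
        rcases le_or_gt (histNorm n r fun θ => x (s + θ)) (N + 1) with hle | hgt
        · have hs0 : 0 ≤ s := ht₀.trans h.le
          have := hC T s _ (d s) hs0 hs (by fun_prop) hle (hd.1 s hs0)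
          exact (mul_le_of_le_one_left (norm_nonneg _) hχ1).trans
            (this.trans (le_abs_self _))
        · have : χ (histNorm n r fun θ => x (s + θ)) = 0 :=
            max_eq_left ((min_le_right _ _).trans (by linarith))
          rw [this, zero_mul]
          exact abs_nonneg _
    obtain ⟨x, hx⟩ := exists_integral_solution (cutoffField r f d χ t₀) t₀ ψ hBc (hcont χ hχ)
      (fun s hs x y hxy => by
        rcases le_or_gt s t₀ with h | h
        · rw [cutoffField_of_le h, cutoffField_of_le h]
        · have heq : EqOn (fun θ => x (s + θ)) (fun θ => y (s + θ)) (Icc (-r) 0) :=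
            fun θ hθ => hxy _ (by linarith [hθ.2])
          rw [cutoffField_of_lt h, cutoffField_of_lt h, histNorm_congr heq,
            hcongr s h hs _ _ (by fun_prop) (by fun_prop) heq])
      (fun s hs x => cutoffField_of_le hs x) (fun T => |C T|) hbd
    have hpast : ∀ t ≤ t₀, x t = ψ t := fun t ht => by
      rw [hx t, intervalIntegral.integral_zero_ae, add_zero]
      refine Eventually.of_forall fun s hs => cutoffField_of_le ?_ x
      rw [uIoc_of_ge ht] at hs
      exact hs.2
    have hinit : ∀ θ ∈ Icc (-r) 0, x (t₀ + θ) = x₀ θ := fun θ hθ => by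
      rw [hpast _ (by linarith [hθ.2])]
      simp [ψ, hθ.1, hθ.2]
    have hVinit : V t₀ (fun θ => x (t₀ + θ)) + 1 ≤ a₁ N := by
      have heq : EqOn (fun θ => x (t₀ + θ)) (fun θ => ψ (t₀ + θ)) (Icc (-r) 0) :=
        fun θ hθ => hpast _ (by linarith [hθ.2])
      have : V t₀ (fun θ => x (t₀ + θ)) = V t₀ (fun θ => ψ (t₀ + θ)) := by
        refine eq_of_forall_dist_le fun ε hε => ?_
        obtain ⟨δ, hδ, H⟩ := hVcont t₀ (fun θ => ψ (t₀ + θ)) ht₀ (by fun_prop) ε hε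
        exact (H t₀ _ ht₀ (by fun_prop) (by
          rw [histNorm_sub_eq_zero hr heq]; simpa using hδ)).le
      rwa [this]
    have hχ1 : ∀ s, t₀ ≤ s → V s (fun θ => x (s + θ)) < V t₀ (fun θ => x (t₀ + θ)) + 1 →
        χ (histNorm n r fun θ => x (s + θ)) = 1 := fun s hs hsv => by
      have h := (hbound s (fun θ => x (s + θ)) (ht₀.trans hs) (by fun_prop)).1
      have hlt := (ha₁.2.1.lt_iff_lt (histNorm_nonneg _) hN0).1 (h.trans_lt (hsv.trans_le hVinit))
      simp only [χ]
      rw [min_eq_left (by linarith), max_eq_right zero_le_one]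
    have hint : ∀ t, IntervalIntegrable (fun s => cutoffField r f d χ t₀ s x) volume t₀ t :=
      intervalIntegrable_of_continuousAt_off_countable hBc
        (fun s hs => ContinuousAt.comp (f := fun s => (s, x)) (hcont χ hχ s hs x) (by fun_prop))
        (fun T s hs => hbd T s hs x) t₀
    have hxt : ∀ t, t₀ ≤ t →
        IntervalIntegrable (fun s => cutoffField r f d χ t₀ s x) volume t₀ t ∧
        x t = x t₀ + ∫ s in t₀..t, cutoffField r f d χ t₀ s x := fun t ht => by
      refine ⟨hint t, ?_⟩
      have hψ : ψ t = ψ t₀ := by simp [ψ, ht]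
      rw [hx t, hpast t₀ le_rfl, hψ]
    have hfield : ∀ s, t₀ < s → cutoffField r f d χ t₀ s x =
        f s (fun θ => x (s + θ)) (d s) := fun s hs => by
      have h := decay t₀ d χ x ht₀ hd hχ hxt (fun s hs => hχ1 s hs.le) s hs.le
      have hexp : Real.exp (t₀ - s) ≤ 1 := Real.exp_le_one_iff.2 (by linarith)
      have hv0 := hVnn t₀ (fun θ => x (t₀ + θ)) ht₀ (by fun_prop)
      rw [cutoffField_of_lt hs, hχ1 s hs.le (by nlinarith), one_smul]
    refine ⟨x, ⟨x.continuous.continuousOn, fun t ht => ?_⟩, hinit⟩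
    have heq : EqOn (fun s => cutoffField r f d χ t₀ s x)
        (fun s => f s (fun θ => x (s + θ)) (d s)) (uIoc t₀ t) := fun s hs => by
      rw [uIoc_of_le ht] at hs
      exact hfield s hs.1
    refine ⟨(hxt t ht).1.congr heq, ?_⟩
    rw [(hxt t ht).2]
    congr 1
    exact intervalIntegral.integral_congr_ae (Eventually.of_forall heq)
  · intro t₀ x₀ d z ht₀ hx₀ hd hz hinit t ht
    obtain ⟨B, -, hBc, -, hcongr⟩ := exists_regular_times hr h3 hd ht₀
    let x : C(ℝ, Euc n) := ⟨fun t => z (max (t₀ - r) t),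
      hz.1.comp_continuous (by fun_prop) fun t => mem_Ici.2 (le_max_left _ _)⟩
    have hxz : ∀ s, t₀ - r ≤ s → x s = z s := fun s hs => by simp [x, hs]
    have hseg : ∀ s, t₀ ≤ s →
        EqOn (fun θ => z (s + θ)) (fun θ => x (s + θ)) (Icc (-r) 0) := fun s hs θ hθ =>
      (hxz _ (by linarith [hθ.1])).symm
    have hsegc : ∀ s, t₀ ≤ s → ContinuousOn (fun θ => z (s + θ)) (Icc (-r) 0) := fun s hs =>
      hz.1.comp (by fun_prop) fun θ hθ => by
        simp only [mem_Ici]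
        linarith [hθ.1]
    have hxt : ∀ t, t₀ ≤ t →
        IntervalIntegrable (fun s => cutoffField r f d (fun _ => 1) t₀ s x) volume t₀ t ∧
        x t = x t₀ + ∫ s in t₀..t, cutoffField r f d (fun _ => 1) t₀ s x := fun t ht => by
      have heq : ∀ᵐ s, s ∈ uIoc t₀ t → f s (fun θ => z (s + θ)) (d s) =
          cutoffField r f d (fun _ => 1) t₀ s x := by
        filter_upwards [hBc.ae_notMem volume] with s hsB hs
        rw [uIoc_of_le ht] at hs
        rw [cutoffField_of_lt hs.1, one_smul]
        exact hcongr s hs.1 hsB _ _ (hsegc s hs.1.le) (by fun_prop) (hseg s hs.1.le)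
      refine ⟨(hz.2 t ht).1.congr_ae ((ae_restrict_iff' measurableSet_uIoc).2 heq), ?_⟩
      rw [hxz t (by linarith), hxz t₀ (by linarith), (hz.2 t ht).2]
      congr 1
      exact intervalIntegral.integral_congr_ae heq
    have hV := decay t₀ d (fun _ => 1) x ht₀ hd continuous_const hxt (fun _ _ _ => rfl) t ht
    have hlow := (hbound t (fun θ => x (t + θ)) (ht₀.trans ht) (by fun_prop)).1
    have hup := (hbound t₀ (fun θ => x (t₀ + θ)) ht₀ (by fun_prop)).2
    have h0 : histNorm n r (fun θ => x (t₀ + θ)) = histNorm n r x₀ :=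
      histNorm_congr fun θ hθ => (hseg t₀ le_rfl hθ).symm.trans (hinit θ hθ)
    rw [h0] at hup
    rw [histNorm_congr (hseg t ht), ← hba _ (histNorm_nonneg _)]
    beta_reduce
    rw [neg_sub]
    exact hbm.monotone (hlow.trans (hV.trans
      (mul_le_mul_of_nonneg_right hup (Real.exp_pos _).le)))

end
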